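/- Let G be an infinite group with a finite generating set X, and suppose that G has rational growth with respect to X. Then there exist constants α ∈ ℤ with α ≥ 0, λ ∈ ℝ with λ ≥ 1, and real constants D > C > 0 such that for all integers n ≥ 1, C·n^α·λⁿ ≤ 𝔖(n) ≤ D·n^α·λⁿ. -/

import Mathlib

/-!
Coornaert's theorem: a non-elementary word-hyperbolic group has purely
exponential growth of balls.
-/

/-- The word length of `g` with respect to a generating set `X`: the least `n` such that
`g` is a product of `n` elements of `X ∪ X⁻¹`. -/
noncomputable def wordLength {G : Type*} [Group G] (X : Set G) (g : G) : ℕ :=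
  sInf {n | ∃ w : List G, w.length = n ∧ (∀ x ∈ w, x ∈ X ∨ x⁻¹ ∈ X) ∧ w.prod = g}

/-- The word metric `d(g,h) = |g⁻¹h|_X`. -/
noncomputable def wordDist {G : Type*} [Group G] (X : Set G) (g h : G) : ℕ :=
  wordLength X (g⁻¹ * h)

/-- `𝔖(n)`, the cardinality of the sphere of radius `n`. -/
noncomputable def sphereCard {G : Type*} [Group G] (X : Set G) (n : ℕ) : ℕ :=
  {g : G | wordLength X g = n}.ncard

/-- `𝔅(n)`, the cardinality of the ball of radius `n`. -/
noncomputable def ballCard {G : Type*} [Group G] (X : Set G) (n : ℕ) : ℕ :=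
  {g : G | wordLength X g ≤ n}.ncard

/-- A (discrete) geodesic in the Cayley graph `Γ(G,X)` from `a` to `b`: the sequence of
vertices visited by a geodesic path, parametrised by arc length. -/
def IsGeodesic {G : Type*} [Group G] (X : Set G) (a b : G) (γ : ℕ → G) : Prop :=
  γ 0 = a ∧ γ (wordDist X a b) = b ∧
    ∀ i j, i ≤ wordDist X a b → j ≤ wordDist X a b →
      wordDist X (γ i) (γ j) = Nat.dist i j

/-- Triangles in the Cayley graph `Γ(G,X)` are `δ`-thin (`δ` a positive integer): every
vertex on one side of a geodesic triangle is at distance at most `δ` from the union of the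
other two sides. -/
def TrianglesThin {G : Type*} [Group G] (X : Set G) (δ : ℕ) : Prop :=
  ∀ (a b c : G) (γ₁ γ₂ γ₃ : ℕ → G),
    IsGeodesic X a b γ₁ → IsGeodesic X b c γ₂ → IsGeodesic X a c γ₃ →
    ∀ i ≤ wordDist X a c, ∃ j,
      (j ≤ wordDist X a b ∧ wordDist X (γ₃ i) (γ₁ j) ≤ δ) ∨
      (j ≤ wordDist X b c ∧ wordDist X (γ₃ i) (γ₂ j) ≤ δ)

/-- A group is virtually cyclic if it has a cyclic subgroup of finite index. -/
def VirtuallyCyclic (G : Type*) [Group G] : Prop :=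
  ∃ H : Subgroup G, IsCyclic H ∧ H.FiniteIndex

/-- A formal power series over `ℤ` is rational if `Q·F = P` for some integer polynomials
`P, Q` with `Q` having nonzero constant term. -/
def PowerSeriesIsRational (F : PowerSeries ℤ) : Prop :=
  ∃ P Q : Polynomial ℤ, Q.coeff 0 ≠ 0 ∧ (Q : PowerSeries ℤ) * F = (P : PowerSeries ℤ)

section WordLength

variable {G : Type*} [Group G] {X : Set G}

theorem exists_word_of_closure_eq_top (hX : Subgroup.closure X = ⊤) (g : G) :
    ∃ w : List G, w.length = wordLength X g ∧ (∀ x ∈ w, x ∈ X ∨ x⁻¹ ∈ X) ∧ w.prod = g := by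
  have hg : g ∈ Submonoid.closure (X ∪ X⁻¹) := by
    rw [← Subgroup.closure_toSubmonoid, hX]; trivial
  obtain ⟨w, hw, hg⟩ := Submonoid.exists_list_of_mem_closure hg
  exact Nat.sInf_mem (s := {n | ∃ w : List G, w.length = n ∧
    (∀ x ∈ w, x ∈ X ∨ x⁻¹ ∈ X) ∧ w.prod = g}) ⟨w.length, w, rfl, hw, hg⟩

theorem wordLength_prod_le {w : List G} (hw : ∀ x ∈ w, x ∈ X ∨ x⁻¹ ∈ X) :
    wordLength X w.prod ≤ w.length :=
  Nat.sInf_le ⟨w, rfl, hw, rfl⟩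

theorem wordLength_mul_le (hX : Subgroup.closure X = ⊤) (g h : G) :
    wordLength X (g * h) ≤ wordLength X g + wordLength X h := by
  obtain ⟨v, hv, hvX, rfl⟩ := exists_word_of_closure_eq_top hX g
  obtain ⟨w, hw, hwX, rfl⟩ := exists_word_of_closure_eq_top hX h
  rw [← hv, ← hw, ← List.prod_append, ← List.length_append]
  exact wordLength_prod_le fun x hx => (List.mem_append.1 hx).elim (hvX x) (hwX x)

theorem exists_mul_eq_of_wordLength_eq_add (hX : Subgroup.closure X = ⊤) {m n : ℕ} {g : G}
    (hg : wordLength X g = m + n) :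
    ∃ h k : G, wordLength X h = m ∧ wordLength X k = n ∧ h * k = g := by
  obtain ⟨w, hw, hwX, rfl⟩ := exists_word_of_closure_eq_top hX g
  have hle₁ := wordLength_prod_le (w := w.take m) fun x hx => hwX x (List.mem_of_mem_take hx)
  have hle₂ := wordLength_prod_le (w := w.drop m) fun x hx => hwX x (List.mem_of_mem_drop hx)
  have hmul := wordLength_mul_le hX (w.take m).prod (w.drop m).prod
  have hprod : (w.take m).prod * (w.drop m).prod = w.prod := List.prod_take_mul_prod_drop w m
  rw [hprod] at hmul
  rw [List.length_take] at hle₁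
  rw [List.length_drop] at hle₂
  exact ⟨_, _, by lia, by lia, hprod⟩

theorem setOf_wordLength_eq_add_subset (hX : Subgroup.closure X = ⊤) (m n : ℕ) :
    {g : G | wordLength X g = m + n} ⊆
      Set.image2 (· * ·) {g : G | wordLength X g = m} {g : G | wordLength X g = n} := by
  intro g hg
  obtain ⟨h, k, hh, hk, rfl⟩ := exists_mul_eq_of_wordLength_eq_add hX hg
  exact ⟨h, hh, k, hk, rfl⟩

theorem finite_setOf_wordLength_eq (hX : Subgroup.closure X = ⊤) (hfin : X.Finite) (n : ℕ) :
    {g : G | wordLength X g = n}.Finite := by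
  induction n with
  | zero =>
    refine (Set.finite_singleton (1 : G)).subset fun g hg => ?_
    obtain ⟨w, hw, -, rfl⟩ := exists_word_of_closure_eq_top hX g
    rw [show wordLength X w.prod = 0 from hg, List.length_eq_zero_iff] at hw
    simp [hw]
  | succ n ih =>
    refine (Set.Finite.image2 _ ih ?_).subset (setOf_wordLength_eq_add_subset hX n 1)
    refine (hfin.union (hfin.preimage (inv_injective.injOn))).subset fun g hg => ?_
    obtain ⟨w, hw, hwX, rfl⟩ := exists_word_of_closure_eq_top hX g
    rw [show wordLength X w.prod = 1 from hg, List.length_eq_one_iff] at hw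
    obtain ⟨x, rfl⟩ := hw
    simpa using hwX

theorem sphereCard_add_le (hX : Subgroup.closure X = ⊤) (hfin : X.Finite) (m n : ℕ) :
    sphereCard X (m + n) ≤ sphereCard X m * sphereCard X n := by
  have hm := finite_setOf_wordLength_eq hX hfin m
  have hn := finite_setOf_wordLength_eq hX hfin n
  calc sphereCard X (m + n)
      ≤ (Set.image2 (· * ·) {g : G | wordLength X g = m} {g : G | wordLength X g = n}).ncard :=
        Set.ncard_le_ncard (setOf_wordLength_eq_add_subset hX m n) (hm.image2 _ hn)
    _ ≤ ({g : G | wordLength X g = m} ×ˢ {g : G | wordLength X g = n}).ncard := by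
        rw [← Set.image_prod]
        exact Set.ncard_image_le (hm.prod hn)
    _ = sphereCard X m * sphereCard X n := Set.ncard_prod

theorem one_le_sphereCard [Infinite G] (hX : Subgroup.closure X = ⊤) (hfin : X.Finite) (n : ℕ) :
    1 ≤ sphereCard X n := by
  have hball : {g : G | wordLength X g < n}.Finite := by
    refine ((Set.finite_Iio n).biUnion
      fun m _ => finite_setOf_wordLength_eq hX hfin m).subset fun g hg => ?_
    exact Set.mem_biUnion (Set.mem_Iio.2 hg) rfl
  obtain ⟨g, hg⟩ := hball.exists_notMem
  obtain ⟨h, -, hh, -, -⟩ := exists_mul_eq_of_wordLength_eq_add hX (g := g)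
    (Nat.add_sub_of_le (not_lt.1 hg)).symm
  exact (Set.ncard_pos (finite_setOf_wordLength_eq hX hfin n)).2 ⟨h, hh⟩

end WordLength

section LinearRecurrence

theorem LinearRecurrence.IsSolution.shift {E : LinearRecurrence ℂ} {u : ℕ → ℂ}
    (hu : E.IsSolution u) : E.IsSolution fun n => u (n + 1) := by
  intro n
  have h := hu (n + 1)
  simp only [add_right_comm] at h ⊢
  exact h

/-- The shift operator on the space of solutions of a linear recurrence. -/
def LinearRecurrence.shiftEnd (E : LinearRecurrence ℂ) : Module.End ℂ E.solSpace where
  toFun u := ⟨fun n => (u : ℕ → ℂ) (n + 1), LinearRecurrence.IsSolution.shift u.2⟩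
  map_add' _ _ := rfl
  map_smul' _ _ := rfl

theorem LinearRecurrence.shiftEnd_pow_apply (E : LinearRecurrence ℂ) (n : ℕ) (u : E.solSpace)
    (m : ℕ) : ((E.shiftEnd ^ n) u : ℕ → ℂ) m = (u : ℕ → ℂ) (m + n) := by
  induction n generalizing u m with
  | zero => rfl
  | succ n ih => rw [pow_succ, Module.End.mul_apply, ih]; rfl

theorem LinearRecurrence.IsSolution.mem_span_choose_mul_pow {E : LinearRecurrence ℂ} {u : ℕ → ℂ}
    (hu : E.IsSolution u) :
    u ∈ Submodule.span ℂ
      (Set.range fun (p : ℂ × ℕ) (n : ℕ) => (n.choose p.2 : ℂ) * p.1 ^ (n - p.2)) := by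
  have : FiniteDimensional ℂ E.solSpace := Module.Finite.equiv E.toInit.symm
  have hmem : (⟨u, hu⟩ : E.solSpace) ∈ ⨆ z, E.shiftEnd.maxGenEigenspace z := by
    rw [Module.End.iSup_maxGenEigenspace_eq_top]; trivial
  suffices h : ∀ v : E.solSpace, v ∈ ⨆ z, E.shiftEnd.maxGenEigenspace z →
      (v : ℕ → ℂ) ∈ Submodule.span ℂ
        (Set.range fun (p : ℂ × ℕ) (n : ℕ) => (n.choose p.2 : ℂ) * p.1 ^ (n - p.2)) from
    h _ hmem
  intro v hv
  refine Submodule.iSup_induction _ (motive := fun v : E.solSpace => (v : ℕ → ℂ) ∈ _) hv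
    (fun z v hv => ?_) (Submodule.zero_mem _) (fun _ _ => Submodule.add_mem _)
  obtain ⟨k, hk⟩ := (Module.End.mem_maxGenEigenspace _ _ _).1 hv
  set N : Module.End ℂ E.solSpace := E.shiftEnd - z • 1 with hN
  have hcomm : Commute N (z • 1) := (Commute.one_right N).smul_right z
  have hvan (j : ℕ) (hj : k ≤ j) : (N ^ j) v = 0 := by
    rw [← Nat.sub_add_cancel hj, pow_add, Module.End.mul_apply, hk, map_zero]
  have hv_eq : (v : ℕ → ℂ) = ∑ j ∈ Finset.range k, ((N ^ j) v : ℕ → ℂ) 0 •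
      fun n : ℕ => (n.choose j : ℂ) * z ^ (n - j) := by
    funext n
    have h₁ : (v : ℕ → ℂ) n = ((E.shiftEnd ^ n) v : ℕ → ℂ) 0 := by
      rw [LinearRecurrence.shiftEnd_pow_apply, zero_add]
    rw [h₁, ← sub_add_cancel E.shiftEnd (z • 1), ← hN, hcomm.add_pow]
    have hterm (j : ℕ) : ((N ^ j * (z • (1 : Module.End ℂ E.solSpace)) ^ (n - j) *
        (n.choose j : Module.End ℂ E.solSpace)) v : ℕ → ℂ) 0 =
        ((N ^ j) v : ℕ → ℂ) 0 * ((n.choose j : ℂ) * z ^ (n - j)) := by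
      rw [smul_pow, one_pow, ← nsmul_one, ← Nat.cast_smul_eq_nsmul ℂ]
      simp
      ring
    have hsum : ((∑ j ∈ Finset.range (n + 1), N ^ j *
        (z • (1 : Module.End ℂ E.solSpace)) ^ (n - j) * (n.choose j : Module.End ℂ E.solSpace)) v :
          ℕ → ℂ) 0 = ∑ j ∈ Finset.range (n + 1),
            ((N ^ j) v : ℕ → ℂ) 0 * ((n.choose j : ℂ) * z ^ (n - j)) := by
      rw [LinearMap.sum_apply, Submodule.coe_sum, Finset.sum_apply]
      exact Finset.sum_congr rfl fun j _ => hterm j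
    rw [hsum, Finset.sum_apply]
    simp only [Pi.smul_apply, smul_eq_mul]
    rw [Finset.sum_subset (Finset.range_mono (le_max_left (n + 1) k)),
      ← Finset.sum_subset (Finset.range_mono (le_max_right (n + 1) k))]
    · intro j _ hj
      rw [hvan j (by simpa using hj)]
      simp
    · intro j _ hj
      rw [Nat.choose_eq_zero_of_lt (by simpa using hj)]
      simp
  rw [hv_eq]
  exact Submodule.sum_mem _ fun j _ =>
    Submodule.smul_mem _ _ (Submodule.subset_span ⟨(z, j), rfl⟩)

theorem PowerSeriesIsRational.exists_isSolution {a : ℕ → ℤ}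
    (h : PowerSeriesIsRational (PowerSeries.mk a)) :
    ∃ E : LinearRecurrence ℂ, E.IsSolution fun n => (a n : ℂ) := by
  obtain ⟨P, Q, hQ, hPQ⟩ := h
  set d := P.natDegree + Q.natDegree + 1 with hd
  refine ⟨⟨d, fun i => -((Q.coeff (d - i) : ℂ) / Q.coeff 0)⟩, fun n => ?_⟩
  have hQ' : (Q.coeff 0 : ℂ) ≠ 0 := by exact_mod_cast hQ
  have hcoeff := congrArg (PowerSeries.coeff (n + d)) hPQ
  rw [PowerSeries.coeff_mul, Polynomial.coeff_coe,
    Polynomial.coeff_eq_zero_of_natDegree_lt (by lia),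
    Finset.Nat.sum_antidiagonal_eq_sum_range_succ_mk] at hcoeff
  simp only [Polynomial.coeff_coe, PowerSeries.coeff_mk] at hcoeff
  rw [← Finset.sum_subset (Finset.range_mono (show d + 1 ≤ (n + d).succ by lia)),
    Finset.sum_range_succ', ← Finset.sum_range_reflect] at hcoeff
  · have hcoeff' := congrArg (Int.cast : ℤ → ℂ) hcoeff
    push_cast at hcoeff'
    simp only [Nat.sub_zero] at hcoeff'
    have hsum : (Q.coeff 0 : ℂ) *
        ∑ i ∈ Finset.range d, -((Q.coeff (d - i) : ℂ) / Q.coeff 0) * (a (n + i) : ℂ) =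
        -∑ i ∈ Finset.range d,
          (Q.coeff (d - 1 - i + 1) : ℂ) * (a (n + d - (d - 1 - i + 1)) : ℂ) := by
      rw [Finset.mul_sum, ← Finset.sum_neg_distrib]
      refine Finset.sum_congr rfl fun i hi => ?_
      rw [Finset.mem_range] at hi
      rw [show d - 1 - i + 1 = d - i by lia, show n + d - (d - i) = n + i by lia]
      field_simp
    dsimp only
    rw [Fin.sum_univ_eq_sum_range
      (fun i => -((Q.coeff (d - i) : ℂ) / Q.coeff 0) * (a (n + i) : ℂ))]
    refine mul_left_cancel₀ hQ' ?_
    linear_combination hcoeff' - hsum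
  · intro i _ hi
    rw [Polynomial.coeff_eq_zero_of_natDegree_lt (by simp at hi; lia), zero_mul]

theorem LinearRecurrence.IsSolution.exists_eventually_eq {E : LinearRecurrence ℂ} {u : ℕ → ℂ}
    (hu : E.IsSolution u) :
    ∃ (s : Finset (ℂ × ℕ)) (c : ℂ × ℕ → ℂ), (∀ p ∈ s, p.1 ≠ 0 ∧ c p ≠ 0) ∧
      ∀ᶠ n in Filter.atTop, u n = ∑ p ∈ s, c p * ((n.choose p.2 : ℂ) * p.1 ^ n) := by
  obtain ⟨c, rfl⟩ := Finsupp.mem_span_range_iff_exists_finsupp.1 hu.mem_span_choose_mul_pow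
  refine ⟨c.support.filter (·.1 ≠ 0), fun p => c p * (p.1 ^ p.2)⁻¹, fun p hp => ?_, ?_⟩
  · simp only [Finset.mem_filter, Finsupp.mem_support_iff] at hp
    exact ⟨hp.2, mul_ne_zero hp.1 (inv_ne_zero (pow_ne_zero _ hp.2))⟩
  · have hlarge : ∀ᶠ n in Filter.atTop, ∀ p ∈ c.support, p.2 < n :=
      (Filter.eventually_all_finset _).2 fun p _ => Filter.eventually_gt_atTop p.2
    filter_upwards [hlarge] with n hn
    rw [Finsupp.sum, Finset.sum_apply, Finset.sum_filter]
    refine Finset.sum_congr rfl fun p hp => ?_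
    have hlt := hn p hp
    split_ifs with h0
    · simp only [Pi.smul_apply, smul_eq_mul]
      rw [pow_sub₀ _ h0 hlt.le]
      ring
    · rw [not_not] at h0
      simp [h0, (Nat.sub_pos_of_lt hlt).ne']

end LinearRecurrence

section ExponentialPolynomials

open Filter Topology

theorem tendsto_choose_div_pow (k : ℕ) :
    Tendsto (fun n : ℕ => (n.choose k : ℝ) / (n : ℝ) ^ k) atTop (𝓝 (k.factorial : ℝ)⁻¹) := by
  have hne : ∀ᶠ n : ℕ in atTop, (n : ℝ) ^ k / k.factorial ≠ 0 := by
    filter_upwards [eventually_gt_atTop 0] with n hn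
    positivity
  have h := ((Asymptotics.isEquivalent_iff_tendsto_one hne).1 (isEquivalent_choose k)).mul_const
    ((k.factorial : ℝ)⁻¹)
  rw [one_mul] at h
  refine h.congr fun n => ?_
  have : (k.factorial : ℝ) ≠ 0 := by positivity
  simp only [Pi.div_apply]
  field_simp

theorem tendsto_choose_mul_pow_div_of_norm_lt {z : ℂ} {L : ℝ} (hz : ‖z‖ < L) (j α : ℕ) :
    Tendsto (fun n : ℕ => (n.choose j : ℂ) * z ^ n / ((n : ℂ) ^ α * (L : ℂ) ^ n)) atTop (𝓝 0) := by
  have hL : 0 < L := (norm_nonneg z).trans_lt hz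
  refine squeeze_zero_norm' ?_ (tendsto_pow_const_mul_const_pow_of_lt_one j
    (div_nonneg (norm_nonneg z) hL.le) ((div_lt_one hL).2 hz))
  filter_upwards [eventually_ge_atTop 1] with n hn
  have hn' : (1 : ℝ) ≤ (n : ℝ) ^ α := one_le_pow₀ (by exact_mod_cast hn)
  have hc : (n.choose j : ℝ) ≤ (n : ℝ) ^ j := by exact_mod_cast Nat.choose_le_pow n j
  simp only [norm_div, norm_mul, norm_pow, Complex.norm_natCast, Complex.norm_real,
    Real.norm_of_nonneg hL.le, div_pow]
  rw [← mul_div_assoc]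
  gcongr
  exact le_mul_of_one_le_left (by positivity) hn'

theorem tendsto_choose_mul_pow_div_of_lt {z : ℂ} {L : ℝ} (hL : 0 < L) (hz : ‖z‖ = L) {j α : ℕ}
    (hj : j < α) :
    Tendsto (fun n : ℕ => (n.choose j : ℂ) * z ^ n / ((n : ℂ) ^ α * (L : ℂ) ^ n)) atTop (𝓝 0) := by
  refine squeeze_zero_norm' ?_ tendsto_inv_atTop_nhds_zero_nat
  filter_upwards [eventually_ge_atTop 1] with n hn
  have hn' : (1 : ℝ) ≤ n := by exact_mod_cast hn
  have hc : (n.choose j : ℝ) ≤ (n : ℝ) ^ j := by exact_mod_cast Nat.choose_le_pow n j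
  have hpow : (n : ℝ) ^ j * n ≤ (n : ℝ) ^ α := by
    rw [← pow_succ]
    exact pow_le_pow_right₀ hn' hj
  simp only [norm_div, norm_mul, norm_pow, Complex.norm_natCast, Complex.norm_real,
    Real.norm_of_nonneg hL.le, hz]
  rw [mul_div_mul_right _ _ (by positivity), inv_eq_one_div,
    div_le_div_iff₀ (by positivity) (by positivity)]
  nlinarith

theorem tendsto_choose_mul_pow_div_sub {z : ℂ} {L : ℝ} (hL : 0 < L) (hz : ‖z‖ = L) (α : ℕ) :
    Tendsto (fun n : ℕ => (n.choose α : ℂ) * z ^ n / ((n : ℂ) ^ α * (L : ℂ) ^ n) -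
      (α.factorial : ℂ)⁻¹ * (z / L) ^ n) atTop (𝓝 0) := by
  have h := (tendsto_choose_div_pow α).sub_const (α.factorial : ℝ)⁻¹
  rw [sub_self] at h
  refine squeeze_zero_norm (fun n => le_of_eq ?_) (tendsto_zero_iff_norm_tendsto_zero.1 h)
  have hone : ‖(z / L) ^ n‖ = 1 := by
    rw [norm_pow, norm_div, Complex.norm_real, Real.norm_of_nonneg hL.le, hz, div_self hL.ne',
      one_pow]
  have hfac : (n.choose α : ℂ) * z ^ n / ((n : ℂ) ^ α * (L : ℂ) ^ n) -
      (α.factorial : ℂ)⁻¹ * (z / L) ^ n =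
      (((n.choose α : ℝ) / (n : ℝ) ^ α - (α.factorial : ℝ)⁻¹ : ℝ) : ℂ) * (z / L) ^ n := by
    push_cast
    rw [div_pow, sub_mul, div_mul_div_comm]
  rw [hfac, norm_mul, hone, mul_one, Complex.norm_real]

/-- The leading part of an exponential polynomial is a nonzero trigonometric polynomial. -/
theorem exists_leading_trigonometric_sum {u : ℕ → ℂ} {s : Finset (ℂ × ℕ)} {c : ℂ × ℕ → ℂ}
    (hs : s.Nonempty) (hc : ∀ p ∈ s, p.1 ≠ 0 ∧ c p ≠ 0)
    (hu : ∀ᶠ n in atTop, u n = ∑ p ∈ s, c p * ((n.choose p.2 : ℂ) * p.1 ^ n)) :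
    ∃ (α : ℕ) (L : ℝ) (t : Finset ℂ) (e : ℂ → ℂ), 0 < L ∧ t.Nonempty ∧
      (∀ w ∈ t, ‖w‖ = 1 ∧ e w ≠ 0) ∧
      Tendsto (fun n : ℕ => u n / ((n : ℂ) ^ α * (L : ℂ) ^ n) - ∑ w ∈ t, e w * w ^ n)
        atTop (𝓝 0) := by
  obtain ⟨q, hq, hmax⟩ := s.exists_max_image (fun p => toLex (‖p.1‖, p.2)) hs
  set L := ‖q.1‖ with hLdef
  have hL : 0 < L := norm_pos_iff.2 (hc q hq).1
  have hL' : (L : ℂ) ≠ 0 := by exact_mod_cast hL.ne'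
  set lead := s.filter fun p => ‖p.1‖ = L ∧ p.2 = q.2 with hlead
  have hinj : Set.InjOn (fun p : ℂ × ℕ => p.1 / (L : ℂ)) lead := by
    intro p hp p' hp' h
    simp only [hlead, Finset.mem_coe, Finset.mem_filter] at hp hp'
    exact Prod.ext ((div_left_inj' hL').1 h) (hp.2.2.trans hp'.2.2.symm)
  refine ⟨q.2, L, lead.image fun p => p.1 / (L : ℂ),
    fun w => c (w * L, q.2) * (q.2.factorial : ℂ)⁻¹, hL, ?_, ?_, ?_⟩
  · exact Finset.Nonempty.image ⟨q, by simp [hlead, hq, hLdef]⟩ _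
  · simp only [Finset.forall_mem_image]
    intro p hp
    obtain ⟨hps, hpL, hpq⟩ := by simpa [hlead] using hp
    refine ⟨by rw [norm_div, Complex.norm_real, Real.norm_of_nonneg hL.le, hpL, div_self hL.ne'],
      mul_ne_zero ?_ (inv_ne_zero (by exact_mod_cast q.2.factorial_ne_zero))⟩
    rw [div_mul_cancel₀ _ hL', ← hpq]
    exact (hc p hps).2
  · have hterm : ∀ p ∈ s, Tendsto (fun n : ℕ =>
        c p * ((n.choose p.2 : ℂ) * p.1 ^ n / ((n : ℂ) ^ q.2 * (L : ℂ) ^ n) -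
          if ‖p.1‖ = L ∧ p.2 = q.2 then (q.2.factorial : ℂ)⁻¹ * (p.1 / L) ^ n else 0))
        atTop (𝓝 0) := by
      intro p hp
      rw [← mul_zero (c p)]
      refine Tendsto.const_mul _ ?_
      rcases Prod.Lex.le_iff.1 (hmax p hp) with hlt | ⟨heq, hle⟩
      · have hlt' : ‖p.1‖ < L := hlt
        simpa [hlt'.ne] using tendsto_choose_mul_pow_div_of_norm_lt hlt' p.2 q.2
      · have heq' : ‖p.1‖ = L := heq
        rcases (show p.2 ≤ q.2 from hle).lt_or_eq with hlt | hpq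
        · simpa [hlt.ne] using tendsto_choose_mul_pow_div_of_lt hL heq' hlt
        · simpa [heq', hpq] using tendsto_choose_mul_pow_div_sub hL heq' q.2
    have hsum := tendsto_finsetSum s hterm
    rw [Finset.sum_const_zero] at hsum
    refine hsum.congr' ?_
    filter_upwards [hu] with n hn
    rw [hn, Finset.sum_image hinj, hlead, Finset.sum_filter, Finset.sum_div,
      ← Finset.sum_sub_distrib]
    refine Finset.sum_congr rfl fun p _ => ?_
    split_ifs with h
    · rw [div_mul_cancel₀ _ hL', ← h.2]
      ring
    · ring

/-- A trigonometric sum with a nonzero coefficient cannot be small on a long window. -/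
theorem exists_le_sum_norm_trigonometric_sum {t : Finset ℂ} {e : ℂ → ℂ} (ht : t.Nonempty)
    (he : ∀ w ∈ t, ‖w‖ = 1 ∧ e w ≠ 0) :
    ∃ P : Polynomial ℂ, ∃ δ > 0, ∀ n : ℕ,
      δ ≤ ∑ m ∈ P.support, ‖P.coeff m‖ * ‖∑ w ∈ t, e w * w ^ (n + m)‖ := by
  obtain ⟨w₀, hw₀⟩ := ht
  set P : Polynomial ℂ := ∏ w ∈ t.erase w₀, (Polynomial.X - Polynomial.C w) with hP
  have hroot : ∀ w ∈ t, w ≠ w₀ → P.eval w = 0 := by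
    intro w hw hne
    rw [hP, Polynomial.eval_prod]
    exact Finset.prod_eq_zero (Finset.mem_erase.2 ⟨hne, hw⟩) (by simp)
  have hw₀P : P.eval w₀ ≠ 0 := by
    rw [hP, Polynomial.eval_prod, Finset.prod_ne_zero_iff]
    intro w hw
    simpa [sub_eq_zero] using (Finset.ne_of_mem_erase hw).symm
  refine ⟨P, ‖e w₀‖ * ‖P.eval w₀‖,
    mul_pos (norm_pos_iff.2 (he w₀ hw₀).2) (norm_pos_iff.2 hw₀P), fun n => ?_⟩
  have hident : ∑ m ∈ P.support, P.coeff m * ∑ w ∈ t, e w * w ^ (n + m) =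
      e w₀ * w₀ ^ n * P.eval w₀ := by
    simp only [Finset.mul_sum]
    rw [Finset.sum_comm, Finset.sum_eq_single_of_mem w₀ hw₀]
    · rw [Polynomial.eval_eq_sum, Polynomial.sum, Finset.mul_sum]
      exact Finset.sum_congr rfl fun m _ => by ring
    · intro w hw hne
      rw [← mul_zero (e w * w ^ n), ← hroot w hw hne, Polynomial.eval_eq_sum, Polynomial.sum,
        Finset.mul_sum]
      exact Finset.sum_congr rfl fun m _ => by ring
  calc ‖e w₀‖ * ‖P.eval w₀‖ = ‖e w₀ * w₀ ^ n * P.eval w₀‖ := by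
        rw [norm_mul, norm_mul, norm_pow, (he w₀ hw₀).1, one_pow, mul_one]
    _ ≤ _ := by
        rw [← hident]
        exact (norm_sum_le _ _).trans_eq (Finset.sum_congr rfl fun m _ => norm_mul _ _)

end ExponentialPolynomials

section Submultiplicative

open Filter Topology

variable {a : ℕ → ℝ} {α : ℕ} {L : ℝ} {t : Finset ℂ} {e : ℂ → ℂ}

theorem exists_le_mul_pow_of_tendsto (hL : 0 < L) (ht : ∀ w ∈ t, ‖w‖ = 1)
    (hlim : Tendsto (fun n : ℕ => (a n : ℂ) / ((n : ℂ) ^ α * (L : ℂ) ^ n) -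
      ∑ w ∈ t, e w * w ^ n) atTop (𝓝 0)) :
    ∃ D > 0, ∀ n : ℕ, 1 ≤ n → a n ≤ D * (n : ℝ) ^ α * L ^ n := by
  obtain ⟨R, hR⟩ := hlim.norm.bddAbove_range
  have hbound (n : ℕ) : a n / ((n : ℝ) ^ α * L ^ n) ≤ R + ∑ w ∈ t, ‖e w‖ := by
    have h₁ : ‖(a n : ℂ) / ((n : ℂ) ^ α * (L : ℂ) ^ n) - ∑ w ∈ t, e w * w ^ n‖ ≤ R :=
      hR ⟨n, rfl⟩
    have h₂ : ‖∑ w ∈ t, e w * w ^ n‖ ≤ ∑ w ∈ t, ‖e w‖ := by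
      refine (norm_sum_le _ _).trans_eq (Finset.sum_congr rfl fun w hw => ?_)
      rw [norm_mul, norm_pow, ht w hw, one_pow, mul_one]
    have h₃ : a n / ((n : ℝ) ^ α * L ^ n) ≤ ‖(a n : ℂ) / ((n : ℂ) ^ α * (L : ℂ) ^ n)‖ := by
      rw [show (a n : ℂ) / ((n : ℂ) ^ α * (L : ℂ) ^ n) =
        ((a n / ((n : ℝ) ^ α * L ^ n) : ℝ) : ℂ) by push_cast; rfl, Complex.norm_real]
      exact Real.le_norm_self _
    linarith [norm_le_norm_sub_add ((a n : ℂ) / ((n : ℂ) ^ α * (L : ℂ) ^ n))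
      (∑ w ∈ t, e w * w ^ n)]
  refine ⟨max (R + ∑ w ∈ t, ‖e w‖) 1, by positivity, fun n hn => ?_⟩
  have hn' : (0 : ℝ) < n := by exact_mod_cast hn
  rw [mul_assoc, ← div_le_iff₀ (by positivity)]
  exact (hbound n).trans (le_max_left _ _)

theorem exists_mul_pow_le_of_tendsto (hL : 0 < L) (hpos : ∀ n, 0 < a n)
    (hsub : ∀ m n, a (m + n) ≤ a m * a n) (ht : t.Nonempty)
    (hte : ∀ w ∈ t, ‖w‖ = 1 ∧ e w ≠ 0)
    (hlim : Tendsto (fun n : ℕ => (a n : ℂ) / ((n : ℂ) ^ α * (L : ℂ) ^ n) -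
      ∑ w ∈ t, e w * w ^ n) atTop (𝓝 0)) :
    ∃ C > 0, ∀ n : ℕ, 1 ≤ n → C * (n : ℝ) ^ α * L ^ n ≤ a n := by
  obtain ⟨P, δ, hδ, hP⟩ := exists_le_sum_norm_trigonometric_sum ht hte
  set err : ℕ → ℂ := fun n => (a n : ℂ) / ((n : ℂ) ^ α * (L : ℂ) ^ n) - ∑ w ∈ t, e w * w ^ n
    with herr
  set b : ℕ → ℝ := fun n => a n / ((n : ℝ) ^ α * L ^ n) with hb
  have hbpos (n : ℕ) (hn : 1 ≤ n) : 0 < b n := by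
    have := hpos n
    have : (0 : ℝ) < n := by exact_mod_cast hn
    positivity
  have hbadd (n : ℕ) (hn : 1 ≤ n) (m : ℕ) : b (n + m) ≤ a m / L ^ m * b n := by
    have hn' : (0 : ℝ) < n := by exact_mod_cast hn
    have := hpos n
    have := hpos m
    calc b (n + m) ≤ a n * a m / ((n : ℝ) ^ α * L ^ (n + m)) := by
          simp only [hb]
          gcongr
          · exact hsub n m
          · lia
      _ = a m / L ^ m * b n := by
          simp only [hb, pow_add]
          field_simp
  have hnorm (n : ℕ) (hn : 1 ≤ n) : ‖∑ w ∈ t, e w * w ^ n‖ ≤ b n + ‖err n‖ := by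
    have h : ∑ w ∈ t, e w * w ^ n = (b n : ℂ) - err n := by
      simp only [herr, hb]
      push_cast
      ring
    rw [h]
    refine (norm_sub_le _ _).trans_eq ?_
    rw [Complex.norm_real, Real.norm_of_nonneg (hbpos n hn).le]
  set K : ℝ := ∑ m ∈ P.support, ‖P.coeff m‖ * (a m / L ^ m) with hK
  have herr_sum : Tendsto (fun n => ∑ m ∈ P.support, ‖P.coeff m‖ * ‖err (n + m)‖) atTop (𝓝 0) := by
    rw [← Finset.sum_const_zero (s := P.support)]
    refine tendsto_finsetSum _ fun m _ => ?_
    have := ((hlim.comp (tendsto_add_atTop_nat m)).norm).const_mul ‖P.coeff m‖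
    simpa using this
  have hlower : ∀ᶠ n in atTop, δ / 2 ≤ K * b n := by
    filter_upwards [herr_sum.eventually (gt_mem_nhds (half_pos hδ)), eventually_ge_atTop 1]
      with n hn hn₁
    have : ∑ m ∈ P.support, ‖P.coeff m‖ * ‖∑ w ∈ t, e w * w ^ (n + m)‖ ≤
        K * b n + ∑ m ∈ P.support, ‖P.coeff m‖ * ‖err (n + m)‖ := by
      rw [hK, Finset.sum_mul, ← Finset.sum_add_distrib]
      refine Finset.sum_le_sum fun m _ => ?_
      rw [mul_assoc, ← mul_add]
      gcongr
      exact (hnorm (n + m) (by lia)).trans (by gcongr; exact hbadd n hn₁ m)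
    linarith [hP n]
  have hinv : IsBoundedUnder (· ≤ ·) atTop fun n => (b n)⁻¹ := by
    refine isBoundedUnder_of_eventually_le (a := 2 * K / δ) ?_
    filter_upwards [hlower, eventually_ge_atTop 1] with n hn hn₁
    rw [inv_eq_one_div, div_le_div_iff₀ (hbpos n hn₁) hδ]
    linarith
  obtain ⟨R, hR⟩ := hinv.bddAbove_range
  have hRn (n : ℕ) : (b n)⁻¹ ≤ R := hR ⟨n, rfl⟩
  have hRpos : 0 < R := (inv_pos.2 (hbpos 1 le_rfl)).trans_le (hRn 1)
  refine ⟨R⁻¹, inv_pos.2 hRpos, fun n hn => ?_⟩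
  have hn' : (0 : ℝ) < n := by exact_mod_cast hn
  rw [mul_assoc, ← le_div_iff₀ (by positivity)]
  exact inv_le_of_inv_le₀ (hbpos n hn) (hRn n)

theorem one_le_of_one_le_mul_pow {D : ℝ} (hL : 0 < L)
    (h : ∀ n : ℕ, 1 ≤ n → 1 ≤ D * (n : ℝ) ^ α * L ^ n) : 1 ≤ L := by
  by_contra! hlt
  have hlim := (tendsto_pow_const_mul_const_pow_of_lt_one α hL.le hlt).const_mul D
  rw [mul_zero] at hlim
  refine not_le_of_gt one_pos (ge_of_tendsto hlim ?_)
  filter_upwards [eventually_ge_atTop 1] with n hn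
  rw [← mul_assoc]
  exact h n hn

end Submultiplicative

/-- **Theorem (Valiunas).** If `G` is an infinite group with finite generating set `X` and
rational growth, then there are `α ∈ ℤ_{≥0}`, `λ ≥ 1` and `D > C > 0` with
`C n^α λ^n ≤ 𝔖(n) ≤ D n^α λ^n` for all `n ≥ 1`. -/
theorem rational_growth_asymptotics {G : Type*} [Group G] (X : Finset G)
    (hgen : Subgroup.closure (X : Set G) = ⊤) (hinf : Infinite G)
    (hrat : PowerSeriesIsRational
      (PowerSeries.mk fun n => (sphereCard (X : Set G) n : ℤ))) :
    ∃ (α : ℕ) (lam C D : ℝ), 1 ≤ lam ∧ 0 < C ∧ C < D ∧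
      ∀ n : ℕ, 1 ≤ n →
        C * (n : ℝ) ^ α * lam ^ n ≤ (sphereCard (X : Set G) n : ℝ) ∧
        (sphereCard (X : Set G) n : ℝ) ≤ D * (n : ℝ) ^ α * lam ^ n := by
  have : Infinite G := hinf
  have hone (n : ℕ) : (1 : ℝ) ≤ sphereCard (X : Set G) n := by
    exact_mod_cast one_le_sphereCard hgen X.finite_toSet n
  obtain ⟨E, hE⟩ := hrat.exists_isSolution
  obtain ⟨s, c, hc, hs⟩ := hE.exists_eventually_eq
  have hs_nonempty : s.Nonempty := by
    obtain ⟨n, hn⟩ := hs.exists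
    rw [Finset.nonempty_iff_ne_empty]
    rintro rfl
    have hzero : sphereCard (X : Set G) n = 0 := by simpa using hn
    simpa [hzero] using (hone n).trans_lt' one_pos
  obtain ⟨α, L, t, e, hL, ht, hte, hlim⟩ := exists_leading_trigonometric_sum hs_nonempty hc hs
  have hlim' : Filter.Tendsto (fun n : ℕ => (((sphereCard (X : Set G) n : ℝ) : ℂ)) /
      ((n : ℂ) ^ α * (L : ℂ) ^ n) - ∑ w ∈ t, e w * w ^ n) Filter.atTop (nhds 0) := by
    simpa using hlim
  obtain ⟨D, hD, hupper⟩ := exists_le_mul_pow_of_tendsto hL (fun w hw => (hte w hw).1) hlim'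
  obtain ⟨C, hC, hlower⟩ := exists_mul_pow_le_of_tendsto hL (fun n => one_pos.trans_le (hone n))
    (fun m n => by exact_mod_cast sphereCard_add_le hgen X.finite_toSet m n) ht hte hlim'
  refine ⟨α, L, C, C + D, one_le_of_one_le_mul_pow hL fun n hn => (hone n).trans (hupper n hn),
    hC, by linarith, fun n hn => ⟨hlower n hn, (hupper n hn).trans ?_⟩⟩
  gcongr
  linarith
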